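/- Let L be a real number with L > 1. Then there exist no real numbers φ₁, φ₂, φ₃, ψ₁, ψ₂, ψ₃ satisfying simultaneously: e^{iφ₁} + e^{iφ₂} + e^{iφ₃} = −L, e^{iψ₁} + e^{iψ₂} + e^{iψ₃} = −L, and e^{i(φ₁+ψ₁)} + e^{i(φ₂+ψ₂)} + e^{i(φ₃+ψ₃)} = −L. -/

import Mathlib

open Complex

/-- The three unit vectors `exp (2 i aⱼ)` add up to the real number `4 k - 3`. -/
def DoubledAnglesSum (k : ℝ) (a : Fin 3 → ℝ) : Prop :=
  ∑ i, Real.cos (2 * a i) = 4 * k - 3 ∧ ∑ i, Real.sin (2 * a i) = 0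

/-- The sine of the difference of the two angles whose indices are not `i`. -/
noncomputable def sinDiff (a : Fin 3 → ℝ) (i : Fin 3) : ℝ := Real.sin (a (i + 1) - a (i + 2))

lemma sum_fin_three_rotate (f : Fin 3 → ℝ) (i : Fin 3) :
    ∑ j, f j = f i + f (i + 1) + f (i + 2) := by
  fin_cases i <;> simp [Fin.sum_univ_three] <;> ring_nf

lemma prod_fin_three_rotate (f : Fin 3 → ℝ) (i : Fin 3) :
    ∏ j, f j = f i * f (i + 1) * f (i + 2) := by
  fin_cases i <;> simp [Fin.prod_univ_three] <;> ring_nf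

section ProductToSum

variable {x y z : ℝ}

lemma cos_cos_cos_of_add_eq_pi_div_two (h : x + y + z = Real.pi / 2) :
    4 * (Real.cos x * Real.cos y * Real.cos z) =
      Real.sin (2 * x) + Real.sin (2 * y) + Real.sin (2 * z) := by
  obtain rfl : z = Real.pi / 2 - (x + y) := by linarith
  have hx := Real.sin_sq_add_cos_sq x
  have hy := Real.sin_sq_add_cos_sq y
  simp only [Real.sin_two_mul, Real.cos_pi_div_two_sub, Real.sin_pi_div_two_sub,
    Real.sin_add, Real.cos_add]
  grind

lemma sin_sin_cos_of_add_eq_pi_div_two (h : x + y + z = Real.pi / 2) :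
    4 * (Real.sin x * Real.sin y * Real.cos z) =
      Real.sin (2 * x) + Real.sin (2 * y) - Real.sin (2 * z) := by
  obtain rfl : z = Real.pi / 2 - (x + y) := by linarith
  have hx := Real.sin_sq_add_cos_sq x
  have hy := Real.sin_sq_add_cos_sq y
  simp only [Real.sin_two_mul, Real.cos_pi_div_two_sub, Real.sin_pi_div_two_sub,
    Real.sin_add, Real.cos_add]
  grind

lemma sin_sin_sin_of_add_eq_pi_div_two (h : x + y + z = Real.pi / 2) :
    4 * (Real.sin x * Real.sin y * Real.sin z) =
      Real.cos (2 * x) + Real.cos (2 * y) + Real.cos (2 * z) - 1 := by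
  obtain rfl : z = Real.pi / 2 - (x + y) := by linarith
  have hx := Real.sin_sq_add_cos_sq x
  have hy := Real.sin_sq_add_cos_sq y
  simp only [Real.cos_two_mul, Real.cos_pi_div_two_sub, Real.sin_pi_div_two_sub,
    Real.sin_add, Real.cos_add]
  grind

lemma cos_cos_sin_of_add_eq_pi_div_two (h : x + y + z = Real.pi / 2) :
    4 * (Real.cos x * Real.cos y * Real.sin z) =
      Real.cos (2 * x) + Real.cos (2 * y) - Real.cos (2 * z) + 1 := by
  obtain rfl : z = Real.pi / 2 - (x + y) := by linarith
  have hx := Real.sin_sq_add_cos_sq x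
  have hy := Real.sin_sq_add_cos_sq y
  simp only [Real.cos_two_mul, Real.cos_pi_div_two_sub, Real.sin_pi_div_two_sub,
    Real.sin_add, Real.cos_add]
  grind

lemma cos_two_mul_sum_le (h : x + y + z = Real.pi / 2) :
    Real.cos (2 * x) + Real.cos (2 * y) + Real.cos (2 * z) ≤ 3 / 2 := by
  have hz : Real.cos (2 * z) = -Real.cos (2 * x + 2 * y) := by
    rw [← Real.cos_pi_sub]
    congr 1
    linarith
  rw [hz, Real.cos_add]
  nlinarith [sq_nonneg (Real.cos (2 * x) + Real.cos (2 * y) - 1),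
    sq_nonneg (Real.sin (2 * x) - Real.sin (2 * y)), Real.sin_sq_add_cos_sq (2 * x),
    Real.sin_sq_add_cos_sq (2 * y)]

end ProductToSum

/-- The Cauchy-Binet formula for a contraction of a `2 × 2 × 2` tensor of rank at most three,
along a vector orthogonal to one of the factors. -/
lemma det_contraction_of_tensor_sum {k m p₁ q₁ p₂ q₂ p₃ q₃ r₁ s₁ r₂ s₂ r₃ s₃ u₁ v₁ u₂ v₂ u₃ v₃ : ℝ}
    (hccc : p₁ * r₁ * u₁ + p₂ * r₂ * u₂ + p₃ * r₃ * u₃ = 0)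
    (hscc : q₁ * r₁ * u₁ + q₂ * r₂ * u₂ + q₃ * r₃ * u₃ = k)
    (hcsc : p₁ * s₁ * u₁ + p₂ * s₂ * u₂ + p₃ * s₃ * u₃ = k)
    (hccs : p₁ * r₁ * v₁ + p₂ * r₂ * v₂ + p₃ * r₃ * v₃ = k)
    (hssc : q₁ * s₁ * u₁ + q₂ * s₂ * u₂ + q₃ * s₃ * u₃ = 0)
    (hscs : q₁ * r₁ * v₁ + q₂ * r₂ * v₂ + q₃ * r₃ * v₃ = 0)
    (hcss : p₁ * s₁ * v₁ + p₂ * s₂ * v₂ + p₃ * s₃ * v₃ = 0)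
    (hsss : q₁ * s₁ * v₁ + q₂ * s₂ * v₂ + q₃ * s₃ * v₃ = m) :
    k * (m * p₁ ^ 2 - k * q₁ ^ 2) = -((q₃ * p₁ - p₃ * q₁) * (q₁ * p₂ - p₁ * q₂) *
      (s₂ * r₃ - r₂ * s₃) * (v₂ * u₃ - u₂ * v₃)) := by
  obtain ⟨w₂, hw₂⟩ : ∃ w, w = p₁ * q₂ - q₁ * p₂ := ⟨_, rfl⟩
  obtain ⟨w₃, hw₃⟩ : ∃ w, w = p₁ * q₃ - q₁ * p₃ := ⟨_, rfl⟩
  have hcc : w₂ * r₂ * u₂ + w₃ * r₃ * u₃ = p₁ * k := by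
    subst hw₂ hw₃; linear_combination p₁ * hscc - q₁ * hccc
  have hss : w₂ * s₂ * v₂ + w₃ * s₃ * v₃ = p₁ * m := by
    subst hw₂ hw₃; linear_combination p₁ * hsss - q₁ * hcss
  have hcs : w₂ * r₂ * v₂ + w₃ * r₃ * v₃ = -(q₁ * k) := by
    subst hw₂ hw₃; linear_combination p₁ * hscs - q₁ * hccs
  have hsc : w₂ * s₂ * u₂ + w₃ * s₃ * u₃ = -(q₁ * k) := by
    subst hw₂ hw₃; linear_combination p₁ * hssc - q₁ * hcsc
  calc k * (m * p₁ ^ 2 - k * q₁ ^ 2)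
      = (p₁ * k) * (p₁ * m) - (-(q₁ * k)) * (-(q₁ * k)) := by ring
    _ = w₂ * w₃ * ((s₂ * r₃ - r₂ * s₃) * (v₂ * u₃ - u₂ * v₃)) := by
      rw [← hcc, ← hss]; nth_rewrite 1 [← hcs]; rw [← hsc]; ring
    _ = _ := by subst hw₂ hw₃; ring

lemma sq_sin_add_relation {x y z : ℝ} (h : x + y + z = 0) :
    (Real.sin x ^ 2 + Real.sin y ^ 2 + Real.sin z ^ 2) ^ 2 -
      4 * (Real.sin x ^ 2 * Real.sin y ^ 2 + Real.sin y ^ 2 * Real.sin z ^ 2 +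
        Real.sin z ^ 2 * Real.sin x ^ 2) +
      4 * (Real.sin x ^ 2 * Real.sin y ^ 2 * Real.sin z ^ 2) = 0 := by
  obtain rfl : z = -(x + y) := by linarith
  have hx := Real.sin_sq_add_cos_sq x
  have hy := Real.sin_sq_add_cos_sq y
  simp only [Real.sin_neg, Real.sin_add]
  grind

section Rows

variable {k : ℝ} {a b c : Fin 3 → ℝ}

lemma sum_sinDiff_angles (a : Fin 3 → ℝ) (i : Fin 3) :
    (a (i + 1) - a (i + 2)) + (a (i + 1 + 1) - a (i + 1 + 2)) +
      (a (i + 2 + 1) - a (i + 2 + 2)) = 0 := by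
  fin_cases i <;> simp

lemma sinDiff_sq (ha : DoubledAnglesSum k a) (i : Fin 3) :
    4 * sinDiff a i ^ 2 = 3 - (4 * k - 3) ^ 2 + 2 * (4 * k - 3) * Real.cos (2 * a i) := by
  obtain ⟨hc, hs⟩ := ha
  rw [sum_fin_three_rotate _ i] at hc hs
  have h : Real.cos (2 * a (i + 1) - 2 * a (i + 2)) = 1 - 2 * sinDiff a i ^ 2 := by
    rw [sinDiff, ← mul_sub, Real.cos_two_mul, Real.cos_sq']
    ring
  rw [Real.cos_sub] at h
  have h₀ := Real.sin_sq_add_cos_sq (2 * a i)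
  have h₁ := Real.sin_sq_add_cos_sq (2 * a (i + 1))
  have h₂ := Real.sin_sq_add_cos_sq (2 * a (i + 2))
  generalize Real.cos (2 * a i) = c₀ at *
  generalize Real.cos (2 * a (i + 1)) = c₁ at *
  generalize Real.cos (2 * a (i + 2)) = c₂ at *
  generalize Real.sin (2 * a i) = s₀ at *
  generalize Real.sin (2 * a (i + 1)) = s₁ at *
  generalize Real.sin (2 * a (i + 2)) = s₂ at *
  linear_combination 2 * h - h₀ + h₁ + h₂ +
    (c₀ - c₁ - c₂ - (4 * k - 3)) * hc + (s₀ - s₁ - s₂) * hs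

lemma sum_sinDiff_sq (ha : DoubledAnglesSum k a) :
    ∑ i, sinDiff a i ^ 2 = k * (6 - 4 * k) := by
  have h := ha.1
  have h₀ := sinDiff_sq ha 0
  have h₁ := sinDiff_sq ha 1
  have h₂ := sinDiff_sq ha 2
  rw [Fin.sum_univ_three] at h ⊢
  linear_combination (h₀ + h₁ + h₂) / 4 + (4 * k - 3) / 2 * h

lemma sinDiff_relation (a : Fin 3 → ℝ) :
    (∑ i, sinDiff a i ^ 2) ^ 2 -
      4 * (sinDiff a 0 ^ 2 * sinDiff a 1 ^ 2 + sinDiff a 1 ^ 2 * sinDiff a 2 ^ 2 +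
        sinDiff a 2 ^ 2 * sinDiff a 0 ^ 2) + 4 * (∏ i, sinDiff a i) ^ 2 = 0 := by
  have h : (sinDiff a 0 ^ 2 + sinDiff a 1 ^ 2 + sinDiff a 2 ^ 2) ^ 2 -
      4 * (sinDiff a 0 ^ 2 * sinDiff a 1 ^ 2 + sinDiff a 1 ^ 2 * sinDiff a 2 ^ 2 +
        sinDiff a 2 ^ 2 * sinDiff a 0 ^ 2) +
      4 * (sinDiff a 0 ^ 2 * sinDiff a 1 ^ 2 * sinDiff a 2 ^ 2) = 0 :=
    sq_sin_add_relation (sum_sinDiff_angles a 0)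
  rw [Fin.sum_univ_three, Fin.prod_univ_three]
  linear_combination h

lemma sinDiff_quadratic (ha : DoubledAnglesSum k a) (hb : DoubledAnglesSum k b)
    (hc : DoubledAnglesSum k c) (h : ∀ i, a i + b i + c i = Real.pi / 2) (i : Fin 3) :
    k * (sinDiff a i ^ 2 * (sinDiff a i ^ 2 - k * (5 - 4 * k))) +
      (∏ j, sinDiff a j) * (sinDiff a i * sinDiff b i * sinDiff c i) = 0 := by
  have hM := sinDiff_sq ha i
  obtain ⟨hac, has⟩ := ha
  obtain ⟨hbc, hbs⟩ := hb
  obtain ⟨hcc, hcs⟩ := hc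
  rw [sum_fin_three_rotate _ i] at hac has hbc hbs hcc hcs
  have h₁ : ∀ j, b j + c j + a j = Real.pi / 2 := fun j => by linarith [h j]
  have h₂ : ∀ j, c j + a j + b j = Real.pi / 2 := fun j => by linarith [h j]
  have key := det_contraction_of_tensor_sum (k := k) (m := 3 * (k - 1))
    (p₁ := Real.cos (a i)) (q₁ := Real.sin (a i))
    (p₂ := Real.cos (a (i + 1))) (q₂ := Real.sin (a (i + 1)))
    (p₃ := Real.cos (a (i + 2))) (q₃ := Real.sin (a (i + 2)))
    (r₁ := Real.cos (b i)) (s₁ := Real.sin (b i))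
    (r₂ := Real.cos (b (i + 1))) (s₂ := Real.sin (b (i + 1)))
    (r₃ := Real.cos (b (i + 2))) (s₃ := Real.sin (b (i + 2)))
    (u₁ := Real.cos (c i)) (v₁ := Real.sin (c i))
    (u₂ := Real.cos (c (i + 1))) (v₂ := Real.sin (c (i + 1)))
    (u₃ := Real.cos (c (i + 2))) (v₃ := Real.sin (c (i + 2)))
    (by linarith [cos_cos_cos_of_add_eq_pi_div_two (h i),
      cos_cos_cos_of_add_eq_pi_div_two (h (i + 1)), cos_cos_cos_of_add_eq_pi_div_two (h (i + 2))])
    (by linarith [cos_cos_sin_of_add_eq_pi_div_two (h₁ i),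
      cos_cos_sin_of_add_eq_pi_div_two (h₁ (i + 1)),
      cos_cos_sin_of_add_eq_pi_div_two (h₁ (i + 2))])
    (by linarith [cos_cos_sin_of_add_eq_pi_div_two (h₂ i),
      cos_cos_sin_of_add_eq_pi_div_two (h₂ (i + 1)),
      cos_cos_sin_of_add_eq_pi_div_two (h₂ (i + 2))])
    (by linarith [cos_cos_sin_of_add_eq_pi_div_two (h i),
      cos_cos_sin_of_add_eq_pi_div_two (h (i + 1)), cos_cos_sin_of_add_eq_pi_div_two (h (i + 2))])
    (by linarith [sin_sin_cos_of_add_eq_pi_div_two (h i),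
      sin_sin_cos_of_add_eq_pi_div_two (h (i + 1)), sin_sin_cos_of_add_eq_pi_div_two (h (i + 2))])
    (by linarith [sin_sin_cos_of_add_eq_pi_div_two (h₂ i),
      sin_sin_cos_of_add_eq_pi_div_two (h₂ (i + 1)),
      sin_sin_cos_of_add_eq_pi_div_two (h₂ (i + 2))])
    (by linarith [sin_sin_cos_of_add_eq_pi_div_two (h₁ i),
      sin_sin_cos_of_add_eq_pi_div_two (h₁ (i + 1)),
      sin_sin_cos_of_add_eq_pi_div_two (h₁ (i + 2))])
    (by linarith [sin_sin_sin_of_add_eq_pi_div_two (h i),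
      sin_sin_sin_of_add_eq_pi_div_two (h (i + 1)), sin_sin_sin_of_add_eq_pi_div_two (h (i + 2))])
  have e₁ : i + 1 + 1 = i + 2 := by fin_cases i <;> rfl
  have e₂ : i + 1 + 2 = i := by fin_cases i <;> rfl
  have e₃ : i + 2 + 1 = i := by fin_cases i <;> rfl
  have e₄ : i + 2 + 2 = i + 1 := by fin_cases i <;> rfl
  simp only [← Real.sin_sub] at key
  rw [prod_fin_three_rotate _ i]
  have hA₁ : sinDiff a (i + 1) = Real.sin (a (i + 2) - a i) := by rw [sinDiff, e₁, e₂]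
  have hA₂ : sinDiff a (i + 2) = Real.sin (a i - a (i + 1)) := by rw [sinDiff, e₃, e₄]
  rw [← hA₁, ← hA₂, ← sinDiff, ← sinDiff] at key
  rw [Real.cos_two_mul] at hM
  have hcs := Real.sin_sq_add_cos_sq (a i)
  linear_combination sinDiff a i ^ 2 * key + k * sinDiff a i ^ 2 * hM / 4 +
    k ^ 2 * sinDiff a i ^ 2 * hcs

lemma sinDiff_column_relation (h : ∀ i, a i + b i + c i = Real.pi / 2) (i : Fin 3) :
    (sinDiff a i ^ 2 + sinDiff b i ^ 2 + sinDiff c i ^ 2) ^ 2 -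
      4 * (sinDiff a i ^ 2 * sinDiff b i ^ 2 + sinDiff b i ^ 2 * sinDiff c i ^ 2 +
        sinDiff c i ^ 2 * sinDiff a i ^ 2) +
      4 * (sinDiff a i ^ 2 * sinDiff b i ^ 2 * sinDiff c i ^ 2) = 0 :=
  sq_sin_add_relation (by linarith [h (i + 1), h (i + 2)])

/-- The product of the sines of the differences is a root of a quadratic polynomial that does
not depend on which of the three triples of angles is considered. -/
lemma prod_sinDiff_quadratic (ha : DoubledAnglesSum k a) (hb : DoubledAnglesSum k b)
    (hc : DoubledAnglesSum k c) (h : ∀ i, a i + b i + c i = Real.pi / 2) :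
    2 * k * (∏ i, sinDiff a i) ^ 2 -
      (∑ i, sinDiff a i * sinDiff b i * sinDiff c i) * (∏ i, sinDiff a i) =
      k ^ 3 * (6 - 4 * k) * (2 * k - 2) := by
  have hE := sum_sinDiff_sq ha
  have hR := sinDiff_relation a
  have h₀ := sinDiff_quadratic ha hb hc h 0
  have h₁ := sinDiff_quadratic ha hb hc h 1
  have h₂ := sinDiff_quadratic ha hb hc h 2
  rw [hE] at hR
  rw [Fin.sum_univ_three] at hE ⊢
  generalize (∏ i, sinDiff a i) = σ at *
  linear_combination -(h₀ + h₁ + h₂) + k / 2 * hR +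
    k * (sinDiff a 0 ^ 2 + sinDiff a 1 ^ 2 + sinDiff a 2 ^ 2 + k * (6 - 4 * k) -
      k * (5 - 4 * k)) * hE

lemma prod_sinDiff_ne_zero (hk : 1 < k) (hk' : k < 3 / 2) (ha : DoubledAnglesSum k a)
    (hb : DoubledAnglesSum k b) (hc : DoubledAnglesSum k c)
    (h : ∀ i, a i + b i + c i = Real.pi / 2) : ∏ i, sinDiff a i ≠ 0 := by
  intro h₀
  have hq := prod_sinDiff_quadratic ha hb hc h
  have hpos : 0 < k ^ 3 * (6 - 4 * k) * (2 * k - 2) :=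
    mul_pos (mul_pos (by positivity) (by linarith)) (by linarith)
  rw [h₀] at hq
  linarith

lemma sinDiff_sq_le_one (a : Fin 3 → ℝ) (i : Fin 3) : sinDiff a i ^ 2 ≤ 1 :=
  Real.sin_sq_le_one _

lemma sinDiff_sq_eq_of_prod_eq (hk : 1 < k) (ha : DoubledAnglesSum k a)
    (hb : DoubledAnglesSum k b) (hc : DoubledAnglesSum k c)
    (h : ∀ i, a i + b i + c i = Real.pi / 2) (hab : ∏ i, sinDiff a i = ∏ i, sinDiff b i)
    (i : Fin 3) : sinDiff b i ^ 2 = sinDiff a i ^ 2 := by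
  have hq : (sinDiff b i ^ 2 - sinDiff a i ^ 2) *
      (sinDiff b i ^ 2 + sinDiff a i ^ 2 - k * (5 - 4 * k)) = 0 := by
    have h₁ := sinDiff_quadratic ha hb hc h i
    have h₂ := sinDiff_quadratic hb hc ha (fun j => by linarith [h j]) i
    rw [← hab] at h₂
    refine (mul_eq_zero.1 (?_ : k * _ = 0)).resolve_left (by linarith)
    linear_combination h₂ - h₁
  have hEa := sum_sinDiff_sq ha
  have hEb := sum_sinDiff_sq hb
  have hRa := sinDiff_relation a
  have hRb := sinDiff_relation b
  rw [← hab, hEb] at hRb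
  rw [hEa] at hRa
  have hP : (∏ j, sinDiff a j) ^ 2 = (∏ j, sinDiff b j) ^ 2 := by rw [hab]
  simp only [← Finset.prod_pow] at hP
  rw [sum_fin_three_rotate _ i] at hEa hEb
  rw [prod_fin_three_rotate _ i, prod_fin_three_rotate _ i] at hP
  have hrot : ∀ f : Fin 3 → ℝ, f 0 * f 1 + f 1 * f 2 + f 2 * f 0 =
      f i * f (i + 1) + f (i + 1) * f (i + 2) + f (i + 2) * f i := by
    intro f
    fin_cases i <;> simp <;> ring_nf
  have hRa' := hrot (fun j => sinDiff a j ^ 2)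
  have hRb' := hrot (fun j => sinDiff b j ^ 2)
  rw [hRa'] at hRa
  rw [hRb'] at hRb
  have hle₁ := sinDiff_sq_le_one a (i + 1)
  have hle₂ := sinDiff_sq_le_one a (i + 2)
  generalize sinDiff a i ^ 2 = x₀ at *
  generalize sinDiff a (i + 1) ^ 2 = x₁ at *
  generalize sinDiff a (i + 2) ^ 2 = x₂ at *
  generalize sinDiff b i ^ 2 = y₀ at *
  generalize sinDiff b (i + 1) ^ 2 = y₁ at *
  generalize sinDiff b (i + 2) ^ 2 = y₂ at *
  have hroot : (y₀ - x₀) * ((y₀ - x₁) * (y₀ - x₂)) = 0 := by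
    linear_combination y₀ ^ 2 * (hEb - hEa) - hP + y₀ * (hRb - hRa) / 4
  rcases mul_eq_zero.1 hq with hq | hq
  · linarith
  · rcases mul_eq_zero.1 hroot with h₁ | h₁
    · linarith
    · rcases mul_eq_zero.1 h₁ with h₁ | h₁ <;> nlinarith

lemma not_prod_sinDiff_eq (hk : 1 < k) (hk' : k < 3 / 2) (ha : DoubledAnglesSum k a)
    (hb : DoubledAnglesSum k b) (hc : DoubledAnglesSum k c)
    (h : ∀ i, a i + b i + c i = Real.pi / 2) : ∏ i, sinDiff a i ≠ ∏ i, sinDiff b i := by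
  intro hab
  have hM := sinDiff_sq_eq_of_prod_eq hk ha hb hc h hab
  have hca : ∀ i, c i + a i + b i = Real.pi / 2 := fun i => by linarith [h i]
  have hcne := prod_sinDiff_ne_zero hk hk' hc ha hb hca
  have hane := prod_sinDiff_ne_zero hk hk' ha hb hc h
  have hN : ∀ i, sinDiff c i ^ 2 = 4 * sinDiff a i ^ 2 * (1 - sinDiff a i ^ 2) := by
    intro i
    have hrel := sinDiff_column_relation h i
    rw [hM i] at hrel
    have hne : sinDiff c i ^ 2 ≠ 0 := pow_ne_zero _ (Finset.prod_ne_zero_iff.1 hcne i (by simp))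
    refine mul_left_cancel₀ hne ?_
    linear_combination hrel
  have hac : ∏ i, sinDiff a i ≠ ∏ i, sinDiff c i := by
    intro hac
    have hx : ∀ i, sinDiff a i ^ 2 = 3 / 4 := by
      intro i
      have hNi := hN i
      rw [sinDiff_sq_eq_of_prod_eq hk ha hc hb (fun j => by linarith [h j]) hac i] at hNi
      have hne : sinDiff a i ^ 2 ≠ 0 := pow_ne_zero _ (Finset.prod_ne_zero_iff.1 hane i (by simp))
      refine mul_left_cancel₀ hne ?_
      linear_combination hNi / 4
    have hE := sum_sinDiff_sq ha
    rw [Fin.sum_univ_three, hx, hx, hx] at hE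
    nlinarith
  have hqa := prod_sinDiff_quadratic ha hb hc h
  have hqc := prod_sinDiff_quadratic hc ha hb hca
  have hS : ∑ i, sinDiff c i * sinDiff a i * sinDiff b i =
      ∑ i, sinDiff a i * sinDiff b i * sinDiff c i :=
    Finset.sum_congr rfl fun i _ => by ring
  rw [hS] at hqc
  have hEa := sum_sinDiff_sq ha
  have hEc := sum_sinDiff_sq hc
  have hRa := sinDiff_relation a
  rw [hEa] at hRa
  have hPa : (∏ i, sinDiff a i) ^ 2 = ∏ i, sinDiff a i ^ 2 := (Finset.prod_pow _ _ _).symm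
  have hPc : (∏ i, sinDiff c i) ^ 2 = ∏ i, sinDiff c i ^ 2 := (Finset.prod_pow _ _ _).symm
  rw [Fin.prod_univ_three (fun i => sinDiff a i ^ 2)] at hPa
  rw [Fin.prod_univ_three (fun i => sinDiff c i ^ 2), hN, hN, hN] at hPc
  rw [Fin.sum_univ_three] at hEa hEc
  rw [hN, hN, hN] at hEc
  generalize (∏ i, sinDiff a i) = σ at *
  generalize (∏ i, sinDiff c i) = τ at *
  generalize (∑ i, sinDiff a i * sinDiff b i * sinDiff c i) = S at *
  generalize sinDiff a 0 ^ 2 = x at *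
  generalize sinDiff a 1 ^ 2 = y at *
  generalize sinDiff a 2 ^ 2 = z at *
  obtain ⟨e, he⟩ : ∃ e, e = k * (6 - 4 * k) := ⟨_, rfl⟩
  have he0 : 0 < e := he ▸ mul_pos (by linarith) (by linarith)
  rw [← he] at hEa hEc hRa
  have h₂ : 8 * (x * y + y * z + z * x) = 4 * e ^ 2 - 3 * e := by
    linear_combination hEc + 4 * (x + y + z + e - 1) * hEa
  have hσ : 8 * σ ^ 2 = e * (2 * e - 3) := by
    linear_combination h₂ + 2 * hRa
  have hτ : τ ^ 2 = 16 * σ ^ 2 * (2 - e) ^ 2 := by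
    have h₃ : 4 * ((1 - x) * (1 - y) * (1 - z)) = (2 - e) ^ 2 := by
      linear_combination 4 * hPa - hRa - 4 * hEa
    linear_combination hPc + 16 * σ ^ 2 * h₃ - 64 * ((1 - x) * (1 - y) * (1 - z)) * hPa
  have hστ : τ * σ = -(e * k * (k - 1)) := by
    have : 2 * k * (τ + σ) = S := by
      refine mul_left_cancel₀ (sub_ne_zero.2 hac.symm) ?_
      linear_combination hqc - hqa
    rw [← this] at hqa
    refine mul_left_cancel₀ (show 2 * k ≠ 0 by linarith) ?_
    linear_combination -hqa + 2 * k ^ 2 * (k - 1) * he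
  have hsq : (2 * k * (k - 1)) ^ 2 = ((2 * e - 3) * (2 - e)) ^ 2 := by
    refine mul_left_cancel₀ (pow_ne_zero 2 he0.ne') ?_
    linear_combination (-4 * (τ * σ - e * k * (k - 1))) * hστ + 4 * σ ^ 2 * hτ +
      (2 - e) ^ 2 * (8 * σ ^ 2 + e * (2 * e - 3)) * hσ
  have h₄ : 2 - e = 2 * (2 * k - 1) * (k - 1) := by rw [he]; ring
  have h₅ : 0 < 2 * e - 3 := by
    have : 0 < σ ^ 2 := by positivity
    exact pos_of_mul_pos_right (by linarith : 0 < e * (2 * e - 3)) he0.le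
  have hk1 : 0 < k - 1 := by linarith
  have h₆ : 2 * k * (k - 1) = (2 * e - 3) * (2 - e) :=
    (pow_left_inj₀ (by nlinarith) (mul_nonneg h₅.le (by rw [h₄]; nlinarith)) two_ne_zero).1 hsq
  have h₇ : (k - 1) * ((k - 1) * ((4 * k - 1) * (4 * k - 3))) = 0 := by
    rw [h₄, he] at h₆
    linear_combination h₆ / 2
  have h₈ : 0 < (k - 1) * ((k - 1) * ((4 * k - 1) * (4 * k - 3))) :=
    mul_pos hk1 (mul_pos hk1 (mul_pos (by linarith) (by linarith)))
  linarith

lemma not_exists_doubledAnglesSum (hk : 1 < k) (ha : DoubledAnglesSum k a)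
    (hb : DoubledAnglesSum k b) (hc : DoubledAnglesSum k c)
    (h : ∀ i, a i + b i + c i = Real.pi / 2) : False := by
  have hk' : k < 3 / 2 := by
    have hac := ha.1
    have hbc := hb.1
    have hcc := hc.1
    rw [Fin.sum_univ_three] at hac hbc hcc
    linarith [cos_two_mul_sum_le (h 0), cos_two_mul_sum_le (h 1), cos_two_mul_sum_le (h 2)]
  have h₁ : ∀ i, b i + c i + a i = Real.pi / 2 := fun i => by linarith [h i]
  have h₂ : ∀ i, c i + a i + b i = Real.pi / 2 := fun i => by linarith [h i]
  have hab := not_prod_sinDiff_eq hk hk' ha hb hc h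
  have hbc := not_prod_sinDiff_eq hk hk' hb hc ha h₁
  have hca := not_prod_sinDiff_eq hk hk' hc ha hb h₂
  have hqa := prod_sinDiff_quadratic ha hb hc h
  have hqb := prod_sinDiff_quadratic hb hc ha h₁
  have hqc := prod_sinDiff_quadratic hc ha hb h₂
  have hSb : ∑ i, sinDiff b i * sinDiff c i * sinDiff a i =
      ∑ i, sinDiff a i * sinDiff b i * sinDiff c i :=
    Finset.sum_congr rfl fun i _ => by ring
  have hSc : ∑ i, sinDiff c i * sinDiff a i * sinDiff b i =
      ∑ i, sinDiff a i * sinDiff b i * sinDiff c i :=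
    Finset.sum_congr rfl fun i _ => by ring
  rw [hSb] at hqb
  rw [hSc] at hqc
  generalize (∏ i, sinDiff a i) = x at *
  generalize (∏ i, sinDiff b i) = y at *
  generalize (∏ i, sinDiff c i) = z at *
  generalize (∑ i, sinDiff a i * sinDiff b i * sinDiff c i) = S at *
  have hxy : 2 * k * (x + y) = S := by
    refine mul_left_cancel₀ (sub_ne_zero.2 hab) ?_
    linear_combination hqa - hqb
  have hxz : 2 * k * (z + x) = S := by
    refine mul_left_cancel₀ (sub_ne_zero.2 hca) ?_
    linear_combination hqc - hqa
  refine hbc (mul_left_cancel₀ (show 2 * k ≠ 0 by linarith) ?_)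
  linear_combination hxy - hxz

end Rows

lemma cos_sum_and_sin_sum_of_exp_sum {L x y z : ℝ}
    (h : Complex.exp (x * I) + Complex.exp (y * I) + Complex.exp (z * I) = -(L : ℂ)) :
    Real.cos x + Real.cos y + Real.cos z = -L ∧ Real.sin x + Real.sin y + Real.sin z = 0 := by
  have hre := congrArg Complex.re h
  have him := congrArg Complex.im h
  simp only [add_re, add_im, exp_ofReal_mul_I_re, exp_ofReal_mul_I_im, neg_re, neg_im, ofReal_re,
    ofReal_im, neg_zero] at hre him
  exact ⟨hre, him⟩

lemma doubledAnglesSum_of_exp_sum {L x y z : ℝ}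
    (h : Complex.exp (x * I) + Complex.exp (y * I) + Complex.exp (z * I) = -(L : ℂ)) :
    DoubledAnglesSum ((L + 3) / 4)
      ![(x + Real.pi) / 2, (y + Real.pi) / 2, (z + Real.pi) / 2] := by
  obtain ⟨hc, hs⟩ := cos_sum_and_sin_sum_of_exp_sum h
  simp only [DoubledAnglesSum, Fin.sum_univ_three, Matrix.cons_val]
  simp only [mul_div_cancel₀ _ (two_ne_zero' ℝ), Real.cos_add_pi, Real.sin_add_pi]
  constructor <;> linarith

lemma doubledAnglesSum_neg_of_exp_sum {L x y z : ℝ}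
    (h : Complex.exp (x * I) + Complex.exp (y * I) + Complex.exp (z * I) = -(L : ℂ)) :
    DoubledAnglesSum ((L + 3) / 4)
      ![-(x + Real.pi) / 2, -(y + Real.pi) / 2, -(z + Real.pi) / 2] := by
  obtain ⟨hc, hs⟩ := cos_sum_and_sin_sum_of_exp_sum h
  simp only [DoubledAnglesSum, Fin.sum_univ_three, Matrix.cons_val]
  simp only [mul_div_cancel₀ _ (two_ne_zero' ℝ), Real.cos_neg, Real.sin_neg, Real.cos_add_pi,
    Real.sin_add_pi]
  constructor <;> linarith

theorem no_real_solutions_of_L_gt_one (L : ℝ) (hL : 1 < L) :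
    ¬ ∃ φ₁ φ₂ φ₃ ψ₁ ψ₂ ψ₃ : ℝ,
      Complex.exp (φ₁ * I) + Complex.exp (φ₂ * I) + Complex.exp (φ₃ * I) = -(L : ℂ) ∧
      Complex.exp (ψ₁ * I) + Complex.exp (ψ₂ * I) + Complex.exp (ψ₃ * I) = -(L : ℂ) ∧
      Complex.exp ((φ₁ + ψ₁) * I) + Complex.exp ((φ₂ + ψ₂) * I) +
        Complex.exp ((φ₃ + ψ₃) * I) = -(L : ℂ) := by
  rintro ⟨φ₁, φ₂, φ₃, ψ₁, ψ₂, ψ₃, hφ, hψ, hφψ⟩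
  simp only [← ofReal_add] at hφψ
  refine not_exists_doubledAnglesSum (by linarith) (doubledAnglesSum_of_exp_sum hφ)
    (doubledAnglesSum_of_exp_sum hψ) (doubledAnglesSum_neg_of_exp_sum hφψ) fun i => ?_
  fin_cases i <;> simp <;> ring
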